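/- Let d ≥ 1, m ≥ 2, distinct points p_0,…,p_{m−1} ∈ ℝ^d, λ ∈ (0,1), and f_j(x) = λx + (1−λ)p_j. If x belongs to the attractor S_λ and the set of addresses of x has cardinality strictly less than 2^ℵ₀, then there exist N ∈ ℕ and a word (i_1,…,i_N) ∈ {0,…,m−1}^N such that x ∈ f_{i_1}∘…∘f_{i_N}(U_λ), where U_λ is the set of points with a unique address. In other words, V_λ ⊆ ⋃_{N≥0} ⋃_{(i_1,…,i_N)} f_{i_1}∘…∘f_{i_N}(U_λ). -/

import Mathlib

/-- Composition `f_{w 0} ∘ f_{w 1} ∘ … ∘ f_{w (N-1)}` of members of an IFS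
along a word `w` of length `N`. -/
def compIFS {E : Type*} {m : ℕ} (f : Fin m → E → E) : (N : ℕ) → (Fin N → Fin m) → E → E
  | 0, _ => id
  | N + 1, w => f (w 0) ∘ compIFS f N fun k => w k.succ

section Coding

open Set Topology

variable {E : Type*} [NormedAddCommGroup E] [NormedSpace ℝ E] {m : ℕ}

/-- The point with address `i` in the IFS of ratio `lam` and fixed points `p`. -/
noncomputable def addressPoint (p : Fin m → E) (lam : ℝ) (i : ℕ → Fin m) : E :=
  (lam⁻¹ - 1) • ∑' n : ℕ, lam ^ (n + 1) • p (i n)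

lemma norm_pow_smul_le (p : Fin m → E) {lam : ℝ} (h0 : 0 < lam) (i : ℕ → Fin m) (n : ℕ) :
    ‖lam ^ (n + 1) • p (i n)‖ ≤ lam ^ (n + 1) * ∑ j, ‖p j‖ := by
  rw [norm_smul, Real.norm_of_nonneg (by positivity)]
  gcongr
  exact Finset.single_le_sum (f := fun j => ‖p j‖) (fun _ _ => norm_nonneg _)
    (Finset.mem_univ (i n))

lemma summable_pow_succ_mul {lam : ℝ} (h0 : 0 < lam) (h1 : lam < 1) (c : ℝ) :
    Summable fun n : ℕ => lam ^ (n + 1) * c :=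
  ((summable_nat_add_iff 1).2 (summable_geometric_of_lt_one h0.le h1)).mul_right c

variable [CompleteSpace E]

lemma continuous_addressPoint (p : Fin m → E) {lam : ℝ} (h0 : 0 < lam) (h1 : lam < 1) :
    Continuous (addressPoint p lam) := by
  refine (continuous_tsum (fun n => ?_) (summable_pow_succ_mul h0 h1 (∑ j, ‖p j‖))
    fun n i => norm_pow_smul_le p h0 i n).const_smul _
  exact ((continuous_of_discreteTopology (f := p)).comp (continuous_apply n)).const_smul _

lemma addressPoint_eq_map_shift (p : Fin m → E) {lam : ℝ} (h0 : 0 < lam) (h1 : lam < 1)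
    (i : ℕ → Fin m) :
    addressPoint p lam i =
      lam • addressPoint p lam (fun n => i (n + 1)) + (1 - lam) • p (i 0) := by
  have hs : Summable fun n : ℕ => lam ^ (n + 1) • p (i n) :=
    .of_norm_bounded (summable_pow_succ_mul h0 h1 _) (norm_pow_smul_le p h0 i)
  have hshift : ∑' n : ℕ, lam ^ (n + 1 + 1) • p (i (n + 1)) =
      lam • ∑' n : ℕ, lam ^ (n + 1) • p (i (n + 1)) := by
    rw [← tsum_const_smul'']
    simp only [smul_smul, pow_succ']
  have hc : (lam⁻¹ - 1) * lam = 1 - lam := by field_simp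
  rw [addressPoint, addressPoint, hs.tsum_eq_zero_add, hshift, smul_add, zero_add, pow_one,
    smul_smul, hc, smul_comm lam, add_comm]

lemma addressPoint_eq_compIFS (p : Fin m → E) {lam : ℝ} (h0 : 0 < lam) (h1 : lam < 1)
    {f : Fin m → E → E} (hf : ∀ j x, f j x = lam • x + (1 - lam) • p j) (N : ℕ)
    (i : ℕ → Fin m) :
    addressPoint p lam i =
      compIFS f N (fun k => i k) (addressPoint p lam fun n => i (n + N)) := by
  induction N generalizing i with
  | zero => rfl
  | succ N ih =>
    rw [addressPoint_eq_map_shift p h0 h1, ← hf, ih fun n => i (n + 1)]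
    simp only [compIFS, Function.comp_apply, Fin.val_zero, Fin.val_succ]
    rfl

/-- A nonempty closed subset of a sequence space with fewer than continuum many elements has an
element that is determined, within the set, by one of its finite prefixes. -/
lemma exists_isolated_of_mk_lt_continuum {R : Set (ℕ → Fin m)} (hR : IsClosed R)
    (hne : R.Nonempty) (hcard : Cardinal.mk R < Cardinal.continuum) :
    ∃ i ∈ R, ∃ N : ℕ, ∀ j ∈ R, (∀ n < N, j n = i n) → j = i := by
  have hnot : ¬ Preperfect R := by
    intro hpre
    let _ := TopologicalSpace.upgradeIsCompletelyMetrizable (ℕ → Fin m)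
    obtain ⟨g, hg, -, hinj⟩ := Perfect.exists_nat_bool_injection ⟨hR, hpre⟩ hne
    refine hcard.not_ge ?_
    have h := Cardinal.mk_le_of_injective
      (f := fun b => (⟨g b, hg (mem_range_self b)⟩ : R)) fun a b hab => hinj (congrArg (·.1) hab)
    simpa using h
  simp only [Preperfect, not_forall] at hnot
  obtain ⟨i, hi, hacc⟩ := hnot
  simp only [accPt_iff_nhds, not_forall, not_exists, not_and, not_not] at hacc
  obtain ⟨V, hV, hiso⟩ := hacc
  obtain ⟨W, hWV, hW, hiW⟩ := mem_nhds_iff.1 hV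
  obtain ⟨t, ⟨y, N, rfl⟩, hit, htW⟩ :=
    (PiNat.isTopologicalBasis_cylinders fun _ : ℕ => Fin m).exists_subset_of_mem_open hiW hW
  exact ⟨i, hi, N, fun j hj hji =>
    hiso j ⟨hWV (htW fun n hn => (hji n hn).trans (hit n hn)), hj⟩⟩

end Coding

/-- If `x` belongs to the attractor and has fewer than a continuum of
addresses, then `x ∈ f_{i_1}∘…∘f_{i_N}(U_λ)` for some word `(i_1,…,i_N)`,
where `U_λ` is the set of points with a unique address; i.e.
`V_λ ⊆ ⋃_N ⋃_{(i_1,…,i_N)} f_{i_1}∘…∘f_{i_N}(U_λ)`. -/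
theorem stmt8 (d m : ℕ) (hd : 1 ≤ d) (hm : 2 ≤ m)
    (p : Fin m → EuclideanSpace ℝ (Fin d)) (hp : Function.Injective p)
    (lam : ℝ) (h0 : 0 < lam) (h1 : lam < 1)
    (f : Fin m → EuclideanSpace ℝ (Fin d) → EuclideanSpace ℝ (Fin d))
    (hf : ∀ j x, f j x = lam • x + (1 - lam) • p j)
    (U : Set (EuclideanSpace ℝ (Fin d)))
    (hU : U = {x | ∃! i : ℕ → Fin m,
      x = (lam⁻¹ - 1) • ∑' n : ℕ, lam ^ (n + 1) • p (i n)}) :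
    {x : EuclideanSpace ℝ (Fin d) |
        (∃ i : ℕ → Fin m, x = (lam⁻¹ - 1) • ∑' n : ℕ, lam ^ (n + 1) • p (i n)) ∧
        Cardinal.mk {i : ℕ → Fin m //
          x = (lam⁻¹ - 1) • ∑' n : ℕ, lam ^ (n + 1) • p (i n)} < Cardinal.continuum} ⊆
      ⋃ (N : ℕ), ⋃ (w : Fin N → Fin m), compIFS f N w '' U := by
  rintro x ⟨hne, hcard⟩
  obtain ⟨i, hi, N, hiso⟩ := exists_isolated_of_mk_lt_continuum
    (isClosed_eq continuous_const (continuous_addressPoint p h0 h1)) hne hcard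
  rw [hU]
  refine Set.mem_iUnion₂.2 ⟨N, fun k => i k, addressPoint p lam fun n => i (n + N),
    ⟨fun n => i (n + N), rfl, fun j hj => ?_⟩, ?_⟩
  · let k : ℕ → Fin m := fun n => if n < N then i n else j (n - N)
    have hk : x = addressPoint p lam k := by
      rw [hi.trans (addressPoint_eq_compIFS p h0 h1 hf N i),
        addressPoint_eq_compIFS p h0 h1 hf N k, hj]
      simp [k, addressPoint]
    have hki := hiso k hk fun n hn => if_pos hn
    ext n
    have hn : k (n + N) = j n := by simp [k]
    rw [← hn, hki]
  · exact (hi.trans (addressPoint_eq_compIFS p h0 h1 hf N i)).symm
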